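/- Let n be a nonnegative integer and let q, α, c be complex numbers with q ≠ 0, c ≠ 0, α ≠ 0, α ≠ 1, and such that (q;q)_n, (αq;q)_n, (αc;q)_n and (q²/c;q)_n are all nonzero. Then Σ_{k=0}^{n} [(q^{−n};q)_k (α q^{n+1};q)_k / (q²/c;q)_k] q^k = ((αc;q)_n (q;q)_n / ((q²/c;q)_n (αq;q)_n)) · (α/c)^n q^{n²+2n} · Σ_{j=0}^{n} [(1 − α q^{2j}) (α;q)_j (q/c;q)_j / ((1 − α) (q;q)_j (αc;q)_j)] c^j α^{−j} q^{−j²−j}. -/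

import Mathlib

/-- Finite q-Pochhammer symbol `(x; q)_n`. -/
noncomputable def qPoch (x q : ℂ) (n : ℕ) : ℂ := ∏ k ∈ Finset.range n, (1 - x * q ^ k)

theorem qPoch_zero (x q : ℂ) : qPoch x q 0 = 1 := by simp [qPoch]

theorem qPoch_succ (x q : ℂ) (n : ℕ) : qPoch x q (n + 1) = qPoch x q n * (1 - x * q ^ n) :=
  Finset.prod_range_succ _ _

theorem qPoch_succ_left (x q : ℂ) (n : ℕ) :
    qPoch x q (n + 1) = (1 - x) * qPoch (x * q) q n := by
  simp only [qPoch, Finset.prod_range_succ', pow_zero, mul_one]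
  rw [mul_comm]
  congr 1
  exact Finset.prod_congr rfl fun k _ => by ring

theorem qPoch_ne_zero_of_succ {x q : ℂ} {n : ℕ} (h : qPoch x q (n + 1) ≠ 0) :
    qPoch x q n ≠ 0 ∧ 1 - x * q ^ n ≠ 0 := by
  rwa [qPoch_succ, mul_ne_zero_iff] at h

theorem qPoch_inv_pow_succ {q : ℂ} (hq : q ≠ 0) (n : ℕ) : qPoch (q ^ n)⁻¹ q (n + 1) = 0 := by
  rw [qPoch_succ, inv_mul_cancel₀ (pow_ne_zero n hq), sub_self, mul_zero]

/-- The `k`-th term of the terminated series on the left-hand side. -/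
noncomputable def phiTerm (q α c : ℂ) (n k : ℕ) : ℂ :=
  qPoch (q ^ n)⁻¹ q k * qPoch (α * q ^ (n + 1)) q k / qPoch (q ^ 2 / c) q k * q ^ k

/-- Telescoped creative-telescoping relation for `phiTerm`, summed up to `m`. -/
theorem sum_phiTerm_telescope {q α c : ℂ} (hq : q ≠ 0) (hc : c ≠ 0) (n m : ℕ)
    (h : qPoch (q ^ 2 / c) q m ≠ 0) :
    (1 - q ^ (n + 2) / c) * (1 - α * q ^ (n + 1)) *
        ∑ k ∈ Finset.range (m + 1), phiTerm q α c (n + 1) k -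
      (1 - α * c * q ^ n) * (1 - q ^ (n + 1)) * (α / c) * q ^ (2 * n + 3) *
        ∑ k ∈ Finset.range (m + 1), phiTerm q α c n k =
    q ^ (n + 1) * (1 - q / c) * (1 - α * q ^ (2 * n + 2)) +
      (1 - q ^ (n + 1)) * (1 - α * q ^ (2 * n + 2)) * (1 - α * q ^ (n + 1)) *
        (qPoch (q ^ n)⁻¹ q m * qPoch (α * q ^ (n + 2)) q m / qPoch (q ^ 2 / c) q m) := by
  induction m with
  | zero =>
    simp only [zero_add, Finset.sum_range_one, phiTerm, qPoch_zero]
    field_simp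
    ring
  | succ m ih =>
    obtain ⟨hB, hB'⟩ := qPoch_ne_zero_of_succ h
    have hF : phiTerm q α c (n + 1) (m + 1) =
        (1 - (q ^ (n + 1))⁻¹) * (1 - α * q ^ (n + 2) * q ^ m) * q ^ (m + 1) /
          (1 - q ^ 2 / c * q ^ m) *
        (qPoch (q ^ n)⁻¹ q m * qPoch (α * q ^ (n + 2)) q m / qPoch (q ^ 2 / c) q m) := by
      have e : (q ^ (n + 1))⁻¹ * q = (q ^ n)⁻¹ := by field_simp; ring
      rw [phiTerm, qPoch_succ_left (q ^ (n + 1))⁻¹, e, qPoch_succ (α * _), qPoch_succ (q ^ 2 / c)]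
      field_simp
    have hF' : phiTerm q α c n (m + 1) =
        (1 - (q ^ n)⁻¹ * q ^ m) * (1 - α * q ^ (n + 1)) * q ^ (m + 1) /
          (1 - q ^ 2 / c * q ^ m) *
        (qPoch (q ^ n)⁻¹ q m * qPoch (α * q ^ (n + 2)) q m / qPoch (q ^ 2 / c) q m) := by
      rw [phiTerm, qPoch_succ (q ^ n)⁻¹, qPoch_succ_left (α * _), qPoch_succ (q ^ 2 / c),
        mul_assoc α, ← pow_succ]
      field_simp
    have hG : qPoch (q ^ n)⁻¹ q (m + 1) * qPoch (α * q ^ (n + 2)) q (m + 1) /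
          qPoch (q ^ 2 / c) q (m + 1) =
        (1 - (q ^ n)⁻¹ * q ^ m) * (1 - α * q ^ (n + 2) * q ^ m) / (1 - q ^ 2 / c * q ^ m) *
        (qPoch (q ^ n)⁻¹ q m * qPoch (α * q ^ (n + 2)) q m / qPoch (q ^ 2 / c) q m) := by
      simp only [qPoch_succ]
      field_simp
    rw [Finset.sum_range_succ _ (m + 1), Finset.sum_range_succ _ (m + 1), hF, hF', hG]
    generalize qPoch (q ^ n)⁻¹ q m * qPoch (α * q ^ (n + 2)) q m / qPoch (q ^ 2 / c) q m = u
      at ih ⊢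
    rw [mul_add, mul_add, add_sub_add_comm, ih hB, add_assoc]
    congr 1
    have hd : c - q ^ 2 * q ^ m ≠ 0 := fun h0 => hB' (by field_simp; rw [h0, mul_zero])
    have hd' : 1 - q ^ 2 / c * q ^ m = (c - q ^ 2 * q ^ m) / c := by field_simp
    have hz : q ^ n ≠ 0 := pow_ne_zero n hq
    rw [hd']
    simp only [pow_add, pow_mul', pow_one]
    generalize q ^ n = z at *
    generalize q ^ m = x at *
    field_simp
    ring

theorem sum_phiTerm_succ {q α c : ℂ} (hq : q ≠ 0) (hc : c ≠ 0) (n : ℕ)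
    (h : qPoch (q ^ 2 / c) q (n + 1) ≠ 0) :
    (1 - q ^ (n + 2) / c) * (1 - α * q ^ (n + 1)) *
        ∑ k ∈ Finset.range (n + 2), phiTerm q α c (n + 1) k =
      (1 - α * c * q ^ n) * (1 - q ^ (n + 1)) * (α / c) * q ^ (2 * n + 3) *
        ∑ k ∈ Finset.range (n + 1), phiTerm q α c n k +
      q ^ (n + 1) * (1 - q / c) * (1 - α * q ^ (2 * n + 2)) := by
  have key := sum_phiTerm_telescope (α := α) hq hc n (n + 1) h
  have hlast : phiTerm q α c n (n + 1) = 0 := by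
    simp [phiTerm, qPoch_inv_pow_succ hq]
  rw [qPoch_inv_pow_succ hq, Finset.sum_range_succ (phiTerm q α c n), hlast] at key
  linear_combination key

/-- Lemma 2.4 of the paper: a terminated ₃φ₂ evaluation. -/
theorem statement3 (n : ℕ) (q α c : ℂ)
    (hq : q ≠ 0) (hc : c ≠ 0) (hα0 : α ≠ 0) (hα1 : α ≠ 1)
    (h1 : qPoch q q n ≠ 0) (h2 : qPoch (α * q) q n ≠ 0) (h3 : qPoch (α * c) q n ≠ 0)
    (h4 : qPoch (q ^ 2 / c) q n ≠ 0) :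
    ∑ k ∈ Finset.range (n + 1),
      qPoch (q ^ (-(n : ℤ))) q k * qPoch (α * q ^ (n + 1)) q k /
        qPoch (q ^ 2 / c) q k * q ^ k
    = (qPoch (α * c) q n * qPoch q q n / (qPoch (q ^ 2 / c) q n * qPoch (α * q) q n)) *
      (α / c) ^ n * q ^ (n ^ 2 + 2 * n) *
      ∑ j ∈ Finset.range (n + 1),
        ((1 - α * q ^ (2 * j)) * qPoch α q j * qPoch (q / c) q j /
          ((1 - α) * qPoch q q j * qPoch (α * c) q j)) *
        c ^ j * α ^ (-(j : ℤ)) * q ^ (-((j ^ 2 + j : ℕ) : ℤ)) := by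
  simp only [zpow_neg, zpow_natCast]
  change ∑ k ∈ Finset.range (n + 1), phiTerm q α c n k = _
  induction n with
  | zero =>
    have := sub_ne_zero.2 hα1.symm
    simp [phiTerm, qPoch_zero, this]
  | succ n ih =>
    have hrec := sum_phiTerm_succ (α := α) hq hc n h4
    obtain ⟨h1, h1'⟩ := qPoch_ne_zero_of_succ h1
    obtain ⟨h2, h2'⟩ := qPoch_ne_zero_of_succ h2
    obtain ⟨h3, h3'⟩ := qPoch_ne_zero_of_succ h3
    obtain ⟨h4, h4'⟩ := qPoch_ne_zero_of_succ h4
    have e1 : α * q * q ^ n = α * q ^ (n + 1) := by ring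
    have e2 : q ^ 2 / c * q ^ n = q ^ (n + 2) / c := by ring
    have e3 : q * q ^ n = q ^ (n + 1) := by ring
    rw [e1] at h2'
    rw [e2] at h4'
    rw [e3] at h1'
    have hα : 1 - α ≠ 0 := sub_ne_zero.2 hα1.symm
    apply mul_left_cancel₀ (mul_ne_zero h4' h2')
    rw [hrec, ih h1 h2 h3 h4, Finset.sum_range_succ _ (n + 1), mul_add, mul_add]
    congr 1
    · rw [qPoch_succ (α * c), qPoch_succ q, qPoch_succ (q ^ 2 / c), qPoch_succ (α * q), e1, e2, e3,
        div_pow, div_pow]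
      generalize (∑ j ∈ Finset.range (n + 1), (_ : ℂ)) = S
      generalize 1 - q ^ (n + 2) / c = v at *
      generalize 1 - α * q ^ (n + 1) = w at *
      field_simp
      ring
    · have hA : qPoch α q (n + 1) = (1 - α) * qPoch (α * q) q n := qPoch_succ_left _ _ _
      have hQ : qPoch (q / c) q (n + 1) = (1 - q / c) * qPoch (q ^ 2 / c) q n := by
        rw [qPoch_succ_left, show q / c * q = q ^ 2 / c by ring]
      rw [hA, hQ, qPoch_succ (α * c), qPoch_succ q, qPoch_succ (q ^ 2 / c), qPoch_succ (α * q),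
        e1, e2, e3, div_pow]
      generalize 1 - q ^ (n + 2) / c = v at *
      generalize 1 - α * q ^ (n + 1) = w at *
      generalize 1 - q / c = r at *
      generalize 1 - q ^ (n + 1) = s at *
      field_simp
      ring
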